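/- There is an absolute constant c > 0 such that for every prime p, every a ∈ F_p, every s ∈ F_p, and every positive integer h: if (x+a)·(x+a+1) ∈ R for every x ∈ {s+1, s+2, …, s+h} (the elements s+j for j = 1,…,h in F_p), then h ≤ c · p^{1/4} · log p. -/

import Mathlib

open Finset

/-- The set of nonzero quadratic residues in `F_p`. -/
def quadRes (p : ℕ) [Fact p.Prime] : Finset (ZMod p) :=
  Finset.univ.filter fun x => ∃ y : ZMod p, y ≠ 0 ∧ y ^ 2 = x

section Stepanov

open Polynomial

/-- The cofactor of `f ^ (n - l)` in the `l`-th derivative of `f ^ n * r`, as a linear map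
in `r`. -/
noncomputable def derivCofactor {K : Type*} [Field K] (f : K[X]) (n : ℕ) :
    ℕ → K[X] →ₗ[K] K[X]
  | 0 => LinearMap.id
  | l + 1 =>
    (LinearMap.mulLeft K (((n - l : ℕ) : K[X]) * derivative f) +
      LinearMap.mulLeft K f ∘ₗ derivative) ∘ₗ derivCofactor f n l

theorem iterate_derivative_pow_mul {K : Type*} [Field K] (f r : K[X]) (n l : ℕ) (hl : l ≤ n) :
    derivative^[l] (f ^ n * r) = f ^ (n - l) * derivCofactor f n l r := by
  induction l with
  | zero => simp [derivCofactor]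
  | succ l ih =>
    obtain ⟨m, rfl⟩ : ∃ m, n = m + 1 + l := ⟨n - (l + 1), by omega⟩
    rw [Function.iterate_succ_apply', ih (by omega)]
    have h1 : m + 1 + l - l = m + 1 := by omega
    have h2 : m + 1 + l - (l + 1) = m := by omega
    simp only [derivCofactor, h1, h2, derivative_mul, derivative_pow, LinearMap.comp_apply,
      LinearMap.add_apply, LinearMap.mulLeft_apply]
    simp
    ring

theorem mul_mem_degreeLT_add {K : Type*} [Field K] {f r : K[X]} {d n : ℕ}
    (hf : f.natDegree ≤ d) (hr : r ∈ degreeLT K n) : f * r ∈ degreeLT K (n + d) := by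
  rw [mem_degreeLT] at hr ⊢
  by_cases h0 : r = 0
  · simp [h0]
  by_cases h1 : f = 0
  · simp [h1]
  rw [degree_mul, degree_eq_natDegree h0, degree_eq_natDegree h1] at *
  norm_cast at hr ⊢
  omega

theorem derivCofactor_mem_degreeLT {K : Type*} [Field K] {f r : K[X]} {d D : ℕ} (n l : ℕ)
    (hf : f.natDegree ≤ d) (hr : r ∈ degreeLT K D) :
    derivCofactor f n l r ∈ degreeLT K (D + l * d) := by
  induction l with
  | zero => simpa [derivCofactor] using hr
  | succ l ih =>
    have h : D + (l + 1) * d = D + l * d + d := by ring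
    rw [h]
    simp only [derivCofactor, LinearMap.comp_apply, LinearMap.add_apply, LinearMap.mulLeft_apply]
    refine Submodule.add_mem _ (mul_mem_degreeLT_add ?_ ih) (mul_mem_degreeLT_add hf ?_)
    · refine (natDegree_mul_le).trans ?_
      have := natDegree_derivative_le f
      simp only [natDegree_natCast]
      omega
    · rw [mem_degreeLT] at ih ⊢
      exact (degree_derivative_le).trans_lt ih

theorem pow_char_eq_C_add {p : ℕ} [Fact p.Prime] (f : (ZMod p)[X]) :
    ∃ g : (ZMod p)[X], f ^ p = C (f.eval 0) + X ^ p * g := by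
  refine ⟨(divX f) ^ p, ?_⟩
  conv_lhs => rw [← divX_mul_X_add f]
  rw [add_pow_char, mul_pow, ← C_pow, ZMod.pow_card, ← coeff_zero_eq_eval_zero]
  ring

theorem eq_zero_of_sq_mul_eq {K : Type*} [Field K] {f r s : K[X]} {b c : K} (hc : c ≠ 0)
    (hb : f.rootMultiplicity b = 1) (h : r ^ 2 * f = C c * s ^ 2) : r = 0 ∧ s = 0 := by
  have hf : f ≠ 0 := by rintro rfl; simp at hb
  by_cases hr : r = 0
  · subst hr
    simp [hc] at h
    exact ⟨rfl, h⟩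
  · have hs : s ≠ 0 := by
      rintro rfl
      simp [hr, hf] at h
    exfalso
    have := congrArg (rootMultiplicity b) h
    rw [rootMultiplicity_mul (mul_ne_zero (pow_ne_zero _ hr) hf),
      rootMultiplicity_mul (mul_ne_zero (C_ne_zero.2 hc) (pow_ne_zero _ hs)),
      sq, sq, rootMultiplicity_mul (mul_ne_zero hr hr), rootMultiplicity_mul (mul_ne_zero hs hs),
      rootMultiplicity_C, hb] at this
    omega

theorem eq_zero_of_add_mul_pow_eq_zero {p : ℕ} [Fact p.Prime] (hp : p ≠ 2) {f : (ZMod p)[X]}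
    {b : ZMod p} {d D : ℕ} (h0 : f.eval 0 ≠ 0) (hb : f.rootMultiplicity b = 1)
    (hd : f.natDegree ≤ d) (hD : 2 * D + d ≤ p) {r s A B : (ZMod p)[X]}
    (hr : r ∈ degreeLT _ D) (hs : s ∈ degreeLT _ D)
    (h : (r + X ^ p * A) + (s + X ^ p * B) * f ^ ((p - 1) / 2) = 0) : r = 0 ∧ s = 0 := by
  have hodd := (Fact.out : p.Prime).eq_two_or_odd.resolve_left hp
  have hpow : (f ^ ((p - 1) / 2)) ^ 2 * f = f ^ p := by
    rw [← pow_mul, ← pow_succ]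
    congr 1
    omega
  obtain ⟨g, hg⟩ := pow_char_eq_C_add f
  have hsq : (r + X ^ p * A) ^ 2 * f = (s + X ^ p * B) ^ 2 * (C (f.eval 0) + X ^ p * g) := by
    rw [← hg, ← hpow, eq_neg_of_add_eq_zero_left h]
    ring
  have hdvd : X ^ p ∣ r ^ 2 * f - C (f.eval 0) * s ^ 2 :=
    ⟨(s + X ^ p * B) ^ 2 * g + (2 * s * B + X ^ p * B ^ 2) * C (f.eval 0)
      - (2 * r * A + X ^ p * A ^ 2) * f, by linear_combination hsq⟩
  refine eq_zero_of_sq_mul_eq h0 hb (sub_eq_zero.1 (eq_zero_of_dvd_of_degree_lt hdvd ?_))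
  rw [degree_X_pow, ← mem_degreeLT]
  have natDegree_le : ∀ {q : (ZMod p)[X]}, q ∈ degreeLT (ZMod p) D → q.natDegree ≤ D := by
    intro q hq
    rw [mem_degreeLT] at hq
    exact natDegree_le_of_degree_le hq.le
  have key : ∀ {q : (ZMod p)[X]}, q ∈ degreeLT (ZMod p) D →
      q ^ 2 ∈ degreeLT (ZMod p) (D + D) := by
    intro q hq
    rw [sq]
    exact mul_mem_degreeLT_add (natDegree_le hq) hq
  have mono : degreeLT (ZMod p) (D + D + d) ≤ degreeLT (ZMod p) p :=
    degreeLT_mono (by omega)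
  refine Submodule.sub_mem _ (mono ?_) (mono ?_)
  · rw [mul_comm]
    exact mul_mem_degreeLT_add hd (key hr)
  · exact mul_mem_degreeLT_add (by simp) (key hs)

theorem eq_zero_of_sum_eq_zero {p : ℕ} [Fact p.Prime] (hp : p ≠ 2) {f : (ZMod p)[X]}
    {b : ZMod p} {d D : ℕ} (h0 : f.eval 0 ≠ 0) (hb : f.rootMultiplicity b = 1)
    (hd : f.natDegree ≤ d) (hD : 2 * D + d ≤ p) (J : ℕ) (r s : ℕ → (ZMod p)[X])
    (hr : ∀ j, r j ∈ degreeLT _ D) (hs : ∀ j, s j ∈ degreeLT _ D)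
    (h : ∑ j ∈ range J, (r j + s j * f ^ ((p - 1) / 2)) * (X ^ p) ^ j = 0) :
    ∀ j < J, r j = 0 ∧ s j = 0 := by
  induction J generalizing r s with
  | zero => simp
  | succ J ih =>
    have hsplit : (r 0 + X ^ p * ∑ j ∈ range J, r (j + 1) * (X ^ p) ^ j) +
        (s 0 + X ^ p * ∑ j ∈ range J, s (j + 1) * (X ^ p) ^ j) * f ^ ((p - 1) / 2) = 0 := by
      rw [← h, sum_range_succ']
      have hterm : ∑ j ∈ range J, (r (j + 1) + s (j + 1) * f ^ ((p - 1) / 2)) * (X ^ p) ^ (j + 1) =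
          X ^ p * (∑ j ∈ range J, r (j + 1) * (X ^ p) ^ j) +
          X ^ p * (∑ j ∈ range J, s (j + 1) * (X ^ p) ^ j) * f ^ ((p - 1) / 2) := by
        simp only [mul_sum, sum_mul, ← sum_add_distrib]
        exact sum_congr rfl fun j _ => by ring
      rw [hterm]
      ring
    have hz := eq_zero_of_add_mul_pow_eq_zero hp h0 hb hd hD (hr 0) (hs 0) hsplit
    have htail : ∑ j ∈ range J, (r (j + 1) + s (j + 1) * f ^ ((p - 1) / 2)) * (X ^ p) ^ j = 0 := by
      rw [sum_range_succ', hz.1, hz.2] at h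
      have hX : (X ^ p : (ZMod p)[X]) ≠ 0 := pow_ne_zero _ X_ne_zero
      refine (mul_eq_zero.1 ?_).resolve_left hX
      rw [mul_sum, ← h]
      simp only [zero_mul, add_zero]
      refine sum_congr rfl fun j _ => ?_
      ring
    intro j hj
    cases j with
    | zero => exact hz
    | succ j =>
      exact ih (fun j => r (j + 1)) (fun j => s (j + 1)) (fun j => hr _) (fun j => hs _)
        htail j (by omega)

theorem finrank_degreeLT {K : Type*} [Field K] (n : ℕ) :
    Module.finrank K (degreeLT K n) = n := by
  rw [(degreeLTEquiv K n).finrank_eq]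
  simp

instance {K : Type*} [Field K] (n : ℕ) : FiniteDimensional K (degreeLT K n) :=
  (degreeLTEquiv K n).symm.finiteDimensional

theorem exists_vanishing_cofactors {K : Type*} [Field K] {f : K[X]} {d D J M : ℕ} (n₁ n₂ : ℕ)
    (ε : K) (hf : f.natDegree ≤ d) (hdim : M * (D + M * d + J) < 2 * D * J) :
    ∃ r s : ℕ → K[X], (∀ j, r j ∈ degreeLT K D) ∧ (∀ j, s j ∈ degreeLT K D) ∧
      (∃ j < J, ¬ (r j = 0 ∧ s j = 0)) ∧
      ∀ l < M, ∑ j ∈ range J,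
        (derivCofactor f n₁ l (r j) + C ε * derivCofactor f n₂ l (s j)) * X ^ j = 0 := by
  classical
  let V := Fin J → degreeLT K D
  let poly : Fin M → V × V →ₗ[K] K[X] := fun l =>
    ∑ j : Fin J, LinearMap.mulRight K (X ^ (j : ℕ)) ∘ₗ
      (derivCofactor f n₁ l ∘ₗ (degreeLT K D).subtype ∘ₗ LinearMap.proj j ∘ₗ LinearMap.fst K V V +
      LinearMap.mulLeft K (C ε) ∘ₗ derivCofactor f n₂ l ∘ₗ (degreeLT K D).subtype ∘ₗ
        LinearMap.proj j ∘ₗ LinearMap.snd K V V)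
  have poly_apply : ∀ l v, poly l v = ∑ j : Fin J,
      (derivCofactor f n₁ l (v.1 j) + C ε * derivCofactor f n₂ l (v.2 j)) * X ^ (j : ℕ) := by
    intro l v
    simp [poly]
    rfl
  let Φ : V × V →ₗ[K] (Fin M → Fin (D + M * d + J) → K) :=
    LinearMap.pi fun l => LinearMap.pi fun i => lcoeff K i ∘ₗ poly l
  have hker : LinearMap.ker Φ ≠ ⊥ := by
    apply LinearMap.ker_ne_bot_of_finrank_lt
    have h1 : Module.finrank K V = J * D := by
      simp only [V, Module.finrank_pi_fintype, finrank_degreeLT]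
      simp
    have h2 : Module.finrank K (Fin M → Fin (D + M * d + J) → K) = M * (D + M * d + J) := by
      simp [Module.finrank_pi_fintype]
    rw [Module.finrank_prod, h1, h2]
    linarith
  obtain ⟨v, hv, hv0⟩ := (Submodule.ne_bot_iff _).1 hker
  refine ⟨fun j => if h : j < J then v.1 ⟨j, h⟩ else 0, fun j => if h : j < J then v.2 ⟨j, h⟩ else 0,
    fun j => ?_, fun j => ?_, ?_, fun l hl => ?_⟩
  · dsimp only
    split_ifs
    · exact Subtype.property _
    · exact zero_mem _
  · dsimp only
    split_ifs
    · exact Subtype.property _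
    · exact zero_mem _
  · by_contra! hall
    apply hv0
    have hz : ∀ j : Fin J, (v.1 j : K[X]) = 0 ∧ (v.2 j : K[X]) = 0 := fun j => by
      simpa using hall j j.2
    exact Prod.ext (funext fun j => Subtype.ext (hz j).1) (funext fun j => Subtype.ext (hz j).2)
  · rw [sum_range]
    have hsum : poly ⟨l, hl⟩ v = 0 := by
      have hmem : poly ⟨l, hl⟩ v ∈ degreeLT K (D + M * d + J) := by
        rw [poly_apply]
        refine Submodule.sum_mem _ fun j _ => ?_
        have hle : D + l * d + j ≤ D + M * d + J := by
          have := Nat.mul_le_mul_right d hl.le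
          have := j.2
          omega
        have h₁ := derivCofactor_mem_degreeLT n₁ l hf (v.1 j).2
        have h₂ := mul_mem_degreeLT_add (natDegree_C ε).le
          (derivCofactor_mem_degreeLT n₂ l hf (v.2 j).2)
        have h₃ := mul_mem_degreeLT_add (natDegree_X_pow_le (R := K) (j : ℕ))
          (Submodule.add_mem _ h₁ h₂)
        rw [mul_comm (X ^ (j : ℕ))] at h₃
        exact degreeLT_mono hle h₃
      ext i
      by_cases hi : i < D + M * d + J
      · have := congrFun (congrFun hv ⟨l, hl⟩) ⟨i, hi⟩
        simpa [Φ] using this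
      · rw [mem_degreeLT, degree_lt_iff_coeff_zero] at hmem
        simpa using hmem i (not_lt.1 hi)
    rw [poly_apply] at hsum
    simpa using hsum

theorem iterate_derivative_mul_of_derivative_eq_zero {K : Type*} [Field K] (f g : K[X])
    (hg : derivative g = 0) (l : ℕ) : derivative^[l] (f * g) = derivative^[l] f * g := by
  induction l with
  | zero => rfl
  | succ l ih => simp [Function.iterate_succ_apply', ih, hg]

theorem card_mul_le_natDegree {p : ℕ} [Fact p.Prime] {F : (ZMod p)[X]} (hF : F ≠ 0) {M : ℕ}
    (hM : M ≤ p) (Z : Finset (ZMod p))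
    (hZ : ∀ x ∈ Z, ∀ l < M, (derivative^[l] F).eval x = 0) : M * #Z ≤ F.natDegree := by
  classical
  rcases Nat.eq_zero_or_pos M with rfl | hpos
  · simp
  calc M * #Z = ∑ x ∈ Z, M := by simp [mul_comm]
    _ ≤ ∑ x ∈ Z, F.roots.count x := by
      refine sum_le_sum fun x hx => ?_
      rw [count_roots]
      have := lt_rootMultiplicity_of_isRoot_iterate_derivative_of_mem_nonZeroDivisors
        (n := M - 1) (t := x) hF (fun l hl => hZ x hx l (by omega)) ?_
      · omega
      · refine mem_nonZeroDivisors_of_ne_zero fun h => ?_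
        rw [ZMod.natCast_eq_zero_iff, (Fact.out : p.Prime).dvd_factorial] at h
        omega
    _ ≤ Multiset.card F.roots := by
      rw [← Multiset.toFinset_sum_count_eq]
      exact sum_le_sum_of_ne_zero fun x _ hx => by
        simpa [Multiset.count_eq_zero, and_comm] using hx
    _ ≤ F.natDegree := card_roots' F

/-- Stepanov's bound for the number of `x` with a prescribed value of `f x ^ ((p - 1) / 2)`. -/
theorem card_pow_eq_le {p : ℕ} [Fact p.Prime] (hp : p ≠ 2) {f : (ZMod p)[X]}
    {b : ZMod p} {d m : ℕ} (h0 : f.eval 0 ≠ 0) (hb : f.rootMultiplicity b = 1)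
    (hd : f.natDegree ≤ d) (hd1 : 1 ≤ d) (hdp : 16 * d ≤ p) (hm : 1 ≤ m) (hmp : 16 * m ^ 2 ≤ p)
    (ε : ZMod p) :
    2 * m * #{x : ZMod p | f.eval x ^ ((p - 1) / 2) = ε} ≤ p * m + 2 * p * d := by
  set e := (p - 1) / 2 with he
  obtain ⟨D, hD⟩ : ∃ D, D = (p - d) / 2 := ⟨_, rfl⟩
  have hdim : 2 * m * (D + 2 * m * d + (m + d)) < 2 * D * (m + d) := by
    have h1 : p < 4 * D := by omega
    have h2 : m * (2 * m * d + (m + d)) ≤ 4 * m ^ 2 * d := by nlinarith [Nat.mul_le_mul hm hd1]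
    have h3 : 16 * m ^ 2 * d < 4 * D * d := by nlinarith
    nlinarith
  obtain ⟨r, s, hr, hs, hne, hvan⟩ :=
    exists_vanishing_cofactors (2 * m) (2 * m + e) ε hd hdim
  let F : (ZMod p)[X] := ∑ j ∈ range (m + d),
    (f ^ (2 * m) * r j + f ^ (2 * m + e) * s j) * (X ^ p) ^ j
  have hF : F ≠ 0 := by
    intro hF
    obtain ⟨j, hj, hrs⟩ := hne
    refine hrs (eq_zero_of_sum_eq_zero hp h0 hb hd (by omega) (m + d) r s hr hs ?_ j hj)
    have hf0 : f ^ (2 * m) ≠ 0 := pow_ne_zero _ fun h => by simp [h] at h0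
    refine (mul_eq_zero.1 ?_).resolve_left hf0
    rw [← hF, mul_sum]
    exact sum_congr rfl fun j _ => by rw [pow_add]; ring
  have hvanish : ∀ x ∈ ({x : ZMod p | f.eval x ^ e = ε} : Finset (ZMod p)), ∀ l < 2 * m,
      (derivative^[l] F).eval x = 0 := by
    intro x hx l hl
    have hx' : f.eval x ^ e = ε := by simpa using hx
    have hderiv : derivative^[l] F = ∑ j ∈ range (m + d),
        (f ^ (2 * m - l) * derivCofactor f (2 * m) l (r j) +
          f ^ (2 * m + e - l) * derivCofactor f (2 * m + e) l (s j)) * (X ^ p) ^ j := by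
      simp only [F, iterate_derivative_sum]
      refine sum_congr rfl fun j _ => ?_
      rw [iterate_derivative_mul_of_derivative_eq_zero _ _ (by simp [derivative_pow]),
        iterate_map_add, iterate_derivative_pow_mul _ _ _ _ hl.le,
        iterate_derivative_pow_mul _ _ _ _ (by omega)]
    have hcomb := congrArg (eval x) (hvan l hl)
    rw [hderiv]
    rw [eval_finsetSum, eval_zero] at hcomb
    rw [eval_finsetSum, ← mul_zero (f.eval x ^ (2 * m - l)), ← hcomb, mul_sum]
    refine sum_congr rfl fun j _ => ?_
    have hexp : 2 * m + e - l = (2 * m - l) + e := by omega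
    simp only [eval_mul, eval_add, eval_pow, eval_X, eval_C, hexp, pow_add, hx', ZMod.pow_card]
    ring
  have h4m : 4 * m ≤ p := by nlinarith
  have hcard := card_mul_le_natDegree hF (by omega) _ hvanish
  have hdeg : F.natDegree ≤ D + (2 * m + e) * d + p * (m + d - 1) := by
    refine natDegree_sum_le_of_forall_le _ _ fun j hj => ?_
    have hjle : p * j ≤ p * (m + d - 1) := Nat.mul_le_mul_left _ (by have := mem_range.1 hj; omega)
    have hpoly : ∀ {q : (ZMod p)[X]} {n : ℕ}, q ∈ degreeLT (ZMod p) D → n ≤ 2 * m + e →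
        (f ^ n * q).natDegree ≤ D + (2 * m + e) * d := by
      intro q n hq hn
      have hq' : q.natDegree ≤ D := natDegree_le_of_degree_le (mem_degreeLT.1 hq).le
      have h1 := natDegree_mul_le (p := f ^ n) (q := q)
      have h2 := natDegree_pow_le (p := f) (n := n)
      have h3 := Nat.mul_le_mul hn hd
      omega
    refine natDegree_mul_le.trans ?_
    rw [← pow_mul, natDegree_X_pow]
    exact Nat.add_le_add ((natDegree_add_le _ _).trans
      (max_le (hpoly (hr j) (by omega)) (hpoly (hs j) le_rfl))) hjle
  obtain ⟨t, ht⟩ : ∃ t, m + d = t + 1 := ⟨m + d - 1, by omega⟩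
  have h2e : 2 * e ≤ p := by omega
  have h2D : 2 * D ≤ p := by omega
  have ht' : m + d - 1 = t := by omega
  rw [ht'] at hdeg
  have hed : 2 * (e * d) ≤ p * d := by nlinarith
  have hmd : 4 * (m * d) ≤ p * d := by nlinarith
  have hpt : p * t + p = p * m + p * d := by rw [← mul_add, ht]; ring
  nlinarith

end Stepanov

section CharacterSums

open Polynomial

theorem quadraticChar_eq_indicators {p : ℕ} [Fact p.Prime] (hp : p ≠ 2) (y : ZMod p) :
    quadraticChar (ZMod p) y =
        2 * (if y ^ ((p - 1) / 2) = 1 then 1 else 0) - 1 + (if y = 0 then 1 else 0) ∧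
      quadraticChar (ZMod p) y =
        1 - (if y = 0 then 1 else 0) - 2 * (if y ^ ((p - 1) / 2) = -1 then 1 else 0) := by
  have hprime : p.Prime := Fact.out
  have hodd := hprime.eq_two_or_odd.resolve_left hp
  have htwo := hprime.two_le
  have hchar : ringChar (ZMod p) ≠ 2 := by rwa [ZMod.ringChar_zmod_n]
  have hne : (-1 : ZMod p) ≠ 1 := Ring.neg_one_ne_one_of_char_ne_two hchar
  by_cases hy : y = 0
  · have he : (p - 1) / 2 ≠ 0 := by omega
    simp [hy, he]
  · have hpow : ((quadraticChar (ZMod p) y : ℤ) : ZMod p) = y ^ ((p - 1) / 2) := by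
      rw [quadraticChar_eq_pow_of_char_ne_two' hchar, ZMod.card]
      congr 1
      omega
    rw [← hpow]
    rcases quadraticChar_dichotomy hy with h | h <;> simp [h, hy, hne, hne.symm]

theorem abs_sum_quadraticChar_eval_le {p : ℕ} [Fact p.Prime] (hp : p ≠ 2) {f : (ZMod p)[X]}
    {b : ZMod p} {d m : ℕ} (h0 : f.eval 0 ≠ 0) (hb : f.rootMultiplicity b = 1)
    (hd : f.natDegree ≤ d) (hd1 : 1 ≤ d) (hdp : 16 * d ≤ p) (hm : 1 ≤ m) (hmp : 16 * m ^ 2 ≤ p) :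
    m * |∑ x : ZMod p, quadraticChar (ZMod p) (f.eval x)| ≤ 3 * p * d := by
  have hone := card_pow_eq_le hp h0 hb hd hd1 hdp hm hmp 1
  have hneg := card_pow_eq_le hp h0 hb hd hd1 hdp hm hmp (-1)
  have hf : f ≠ 0 := by rintro rfl; simp at h0
  have hzero : #{x : ZMod p | f.eval x = 0} ≤ d := by
    classical
    calc #{x : ZMod p | f.eval x = 0} ≤ #f.roots.toFinset :=
          card_le_card fun x hx => by simpa [hf] using hx
      _ ≤ f.natDegree := (Multiset.toFinset_card_le _).trans (card_roots' f)
      _ ≤ d := hd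
  have hsum_one : ∑ x : ZMod p, quadraticChar (ZMod p) (f.eval x) =
      2 * #{x : ZMod p | f.eval x ^ ((p - 1) / 2) = 1} - p + #{x : ZMod p | f.eval x = 0} := by
    rw [sum_congr rfl fun x _ => (quadraticChar_eq_indicators hp (f.eval x)).1]
    rw [sum_add_distrib, sum_sub_distrib, ← mul_sum]
    simp
  have hsum_neg : ∑ x : ZMod p, quadraticChar (ZMod p) (f.eval x) =
      p - #{x : ZMod p | f.eval x = 0} -
        2 * #{x : ZMod p | f.eval x ^ ((p - 1) / 2) = -1} := by
    rw [sum_congr rfl fun x _ => (quadraticChar_eq_indicators hp (f.eval x)).2]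
    rw [sum_sub_distrib, sum_sub_distrib, ← mul_sum]
    simp
  have hmd : (m * #{x : ZMod p | f.eval x = 0} : ℤ) ≤ p * d := by
    have hmple : m ≤ p := by nlinarith
    exact_mod_cast Nat.mul_le_mul hmple hzero
  have hone' : (2 * m * #{x : ZMod p | f.eval x ^ ((p - 1) / 2) = 1} : ℤ) ≤
      p * m + 2 * p * d := by exact_mod_cast hone
  have hneg' : (2 * m * #{x : ZMod p | f.eval x ^ ((p - 1) / 2) = -1} : ℤ) ≤
      p * m + 2 * p * d := by exact_mod_cast hneg
  rcases abs_cases (∑ x : ZMod p, quadraticChar (ZMod p) (f.eval x)) with ⟨h, -⟩ | ⟨h, -⟩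
  · rw [h, hsum_one]
    linarith
  · rw [h, hsum_neg]
    linarith

theorem natCast_injOn_of_lt (p : ℕ) {i j : ℕ} (hi : i < p) (hj : j < p)
    (h : (i : ZMod p) = j) : i = j := by
  rw [ZMod.natCast_eq_natCast_iff'] at h
  rwa [Nat.mod_eq_of_lt hi, Nat.mod_eq_of_lt hj] at h

theorem abs_sum_prod_quadraticChar_le {p : ℕ} [Fact p.Prime] (hp : p ≠ 2) {k m : ℕ}
    (hkp : 16 * k ≤ p) (hm : 1 ≤ m) (hmp : 16 * m ^ 2 ≤ p) {S : Finset ℕ} (hS : S ⊆ Icc 1 k)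
    (hne : S.Nonempty) :
    m * |∑ x : ZMod p, ∏ i ∈ S, quadraticChar (ZMod p) (x + i)| ≤ 3 * p * k := by
  obtain ⟨i₀, hi₀⟩ := hne
  have hbound : ∀ i ∈ S, 1 ≤ i ∧ i ≤ k := fun i hi => mem_Icc.1 (hS hi)
  have hk : 1 ≤ k := (hbound i₀ hi₀).1.trans (hbound i₀ hi₀).2
  let f : (ZMod p)[X] := ∏ i ∈ S, (X + C (i : ZMod p))
  have heval : ∀ x, f.eval x = ∏ i ∈ S, (x + i) := fun x => by simp [f, eval_prod]
  have h0 : f.eval 0 ≠ 0 := by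
    rw [heval, prod_ne_zero_iff]
    intro i hi h
    have := hbound i hi
    have := natCast_injOn_of_lt p (i := i) (j := 0) (by omega) (by omega) (by simpa using h)
    omega
  have hb : f.rootMultiplicity (-(i₀ : ZMod p)) = 1 := by
    have hsplit : f = (X - C (-(i₀ : ZMod p))) * ∏ i ∈ S.erase i₀, (X + C (i : ZMod p)) := by
      simp only [f, ← mul_prod_erase S _ hi₀, C_neg, sub_neg_eq_add]
    have hf : f ≠ 0 := by rintro h; simp [h] at h0
    rw [hsplit] at hf ⊢
    rw [rootMultiplicity_mul hf, rootMultiplicity_X_sub_C_self, rootMultiplicity_eq_zero]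
    rw [IsRoot, eval_prod, prod_eq_zero_iff]
    rintro ⟨i, hi, h⟩
    have hi' := mem_erase.1 hi
    have := hbound i hi'.2
    have := hbound i₀ hi₀
    refine hi'.1 (natCast_injOn_of_lt p (by omega) (by omega) ?_)
    simp only [eval_add, eval_X, eval_C] at h
    linear_combination h
  have hd : f.natDegree ≤ k := by
    refine (natDegree_prod_le _ _).trans ?_
    simp only [natDegree_X_add_C, sum_const, smul_eq_mul, mul_one]
    simpa using card_le_card hS
  have := abs_sum_quadraticChar_eval_le hp h0 hb hd hk hkp hm hmp
  simpa [heval] using this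

open Classical in
/-- The `x` such that the quadratic character equals `δ` at `x + 1, …, x + k`. -/
noncomputable def runStarts (p : ℕ) [Fact p.Prime] (k : ℕ) (δ : ℤ) : Finset (ZMod p) :=
  {x | ∀ i ∈ Icc 1 k, quadraticChar (ZMod p) (x + (i : ℕ)) = δ}

theorem mem_runStarts {p : ℕ} [Fact p.Prime] {k : ℕ} {δ : ℤ} {x : ZMod p} :
    x ∈ runStarts p k δ ↔ ∀ i ∈ Icc 1 k, quadraticChar (ZMod p) (x + (i : ℕ)) = δ := by
  simp [runStarts]

/-- A bound for the number of runs of length `k` on which the quadratic character is constant. -/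
theorem card_runs_le {p : ℕ} [Fact p.Prime] (hp : p ≠ 2) {k m : ℕ}
    (hkp : 16 * k ≤ p) (hm : 1 ≤ m) (hmp : 16 * m ^ 2 ≤ p) {δ : ℤ} (hδ : δ = 1 ∨ δ = -1) :
    m * 2 ^ k * #(runStarts p k δ) ≤
      m * p + 2 ^ k * (3 * p * k) := by
  classical
  have hδsq : δ * δ = 1 := by rcases hδ with rfl | rfl <;> norm_num
  have hδabs : |δ| = 1 := by rcases hδ with rfl | rfl <;> norm_num
  let χ := quadraticChar (ZMod p)
  let P : ZMod p → ℤ := fun x => ∏ i ∈ Icc 1 k, (1 + δ * χ (x + (i : ℕ)))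
  have hnonneg : ∀ x, 0 ≤ P x := by
    intro x
    refine prod_nonneg fun i _ => ?_
    have : χ (x + (i : ℕ)) = 0 ∨ χ (x + (i : ℕ)) = 1 ∨ χ (x + (i : ℕ)) = -1 :=
      quadraticChar_isQuadratic (ZMod p) _
    rcases this with h | h | h <;> rcases hδ with rfl | rfl <;> simp [h]
  have hlower : (2 ^ k * #(runStarts p k δ) : ℤ) ≤
      ∑ x, P x := by
    calc (2 ^ k * #(runStarts p k δ) : ℤ)
        = ∑ x ∈ runStarts p k δ, (2 : ℤ) ^ k := by
          simp [mul_comm]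
      _ = ∑ x ∈ runStarts p k δ, P x := by
          refine sum_congr rfl fun x hx => ?_
          have hx' : ∀ i ∈ Icc 1 k, χ (x + (i : ℕ)) = δ := mem_runStarts.1 hx
          have : P x = ∏ i ∈ Icc 1 k, (2 : ℤ) :=
            prod_congr rfl fun i hi => by rw [hx' i hi, hδsq]; norm_num
          simp [this]
      _ ≤ ∑ x, P x := sum_le_univ_sum_of_nonneg hnonneg
  have hexpand : ∑ x, P x =
      ∑ S ∈ (Icc 1 k).powerset, δ ^ #S * ∑ x : ZMod p, ∏ i ∈ S, χ (x + (i : ℕ)) := by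
    simp only [P, prod_one_add, prod_mul_distrib, prod_const]
    rw [sum_comm]
    simp only [mul_sum]
  have hupper : m * ∑ x, P x ≤ m * p + 2 ^ k * (3 * p * k) := by
    rw [hexpand, ← add_sum_erase _ _ (empty_mem_powerset (Icc 1 k)), mul_add]
    refine add_le_add (by simp) ?_
    calc (m : ℤ) * ∑ S ∈ (Icc 1 k).powerset.erase ∅,
          δ ^ #S * ∑ x : ZMod p, ∏ i ∈ S, χ (x + (i : ℕ))
        ≤ ∑ S ∈ (Icc 1 k).powerset.erase ∅, 3 * (p : ℤ) * k := by
          rw [mul_sum]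
          refine sum_le_sum fun S hS => ?_
          obtain ⟨hSne, hS⟩ := mem_erase.1 hS
          refine le_trans ?_ (abs_sum_prod_quadraticChar_le hp hkp hm hmp (mem_powerset.1 hS)
            (nonempty_iff_ne_empty.2 hSne))
          refine mul_le_mul_of_nonneg_left ((le_abs_self _).trans ?_) (by positivity)
          rw [abs_mul, abs_pow, hδabs, one_pow, one_mul]
      _ ≤ ∑ S ∈ (Icc 1 k).powerset, 3 * (p : ℤ) * k :=
          sum_le_sum_of_subset_of_nonneg (erase_subset _ _) fun _ _ _ => by positivity
      _ = 2 ^ k * (3 * p * k) := by simp [card_powerset]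
  have hfinal : (m * 2 ^ k * #(runStarts p k δ) : ℤ) ≤
      m * p + 2 ^ k * (3 * p * k) := by
    rw [mul_assoc]
    exact (mul_le_mul_of_nonneg_left hlower (by positivity)).trans hupper
  exact_mod_cast hfinal

end CharacterSums

section Runs

theorem card_dvd_add_mul_le {a b : ℤ} (hab : IsCoprime a b) {l : ℕ} (hl : l.Prime) (T : ℕ) :
    #{t ∈ range T | (l : ℤ) ∣ b + a * (t : ℕ)} ≤ T / l + 1 := by
  have hprime : Prime (l : ℤ) := Nat.prime_iff_prime_int.1 hl
  have hla : ∀ t : ℕ, (l : ℤ) ∣ b + a * t → ¬ (l : ℤ) ∣ a := by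
    intro t ht hdvd
    have hb : (l : ℤ) ∣ b := (dvd_add_left (hdvd.mul_right _)).1 ht
    exact hprime.not_isUnit (hab.isUnit_of_dvd' hdvd hb)
  rw [← card_range (T / l + 1)]
  refine card_le_card_of_injOn (· / l) (fun t ht => ?_) fun t ht t' ht' h => ?_
  · have := mem_range.1 (mem_filter.1 ht).1
    simpa [Nat.lt_succ_iff] using Nat.div_le_div_right this.le
  · have h1 := (mem_filter.1 ht).2
    have h2 := (mem_filter.1 ht').2
    have hdvd : (l : ℤ) ∣ a * ((t : ℤ) - t') := by
      have := dvd_sub h1 h2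
      ring_nf at this ⊢
      exact this
    have hmod := (hprime.dvd_or_dvd hdvd).resolve_left (hla t h1)
    have hmod' : t % l = t' % l := (Nat.modEq_iff_dvd.2 hmod).symm
    rw [← Nat.div_add_mod t l, ← Nat.div_add_mod t' l, hmod']
    simp only at h
    rw [h]

theorem sum_inv_sq_le {Q : ℕ} (hQ : 1 ≤ Q) :
    ∑ n ∈ Ioc 1 Q, (1 : ℝ) / n ^ 2 ≤ 3 / 4 := by
  rcases hQ.eq_or_lt with rfl | hQ
  · simp; norm_num
  suffices ∑ n ∈ Ioc 1 Q, (1 : ℝ) / n ^ 2 ≤ 3 / 4 - 1 / Q by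
    have : (0 : ℝ) ≤ 1 / Q := by positivity
    linarith
  induction Q, hQ using Nat.le_induction with
  | base => simp; norm_num
  | succ n hn ih =>
    rw [sum_Ioc_succ_top (by omega)]
    have hn0 : (0 : ℝ) < n := by exact_mod_cast (by omega : 0 < n)
    have : (1 : ℝ) / (n + 1 : ℕ) ^ 2 ≤ 1 / n - 1 / (n + 1 : ℕ) := by
      push_cast
      rw [div_sub_div _ _ hn0.ne' (by positivity), div_le_div_iff₀ (by positivity) (by positivity)]
      nlinarith
    have := ih (by omega)
    linarith

open Classical in
/-- Pairs `(q, t)` with `0 < q ≤ Q` and `t < T` for which `b + a t` is coprime to `q`. -/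
noncomputable def coprimePairs (a b : ℤ) (Q T : ℕ) : Finset (ℕ × ℕ) :=
  {x ∈ Ioc 0 Q ×ˢ range T | IsCoprime (b + a * (x.2 : ℤ)) (x.1 : ℤ)}

theorem le_card_coprimePairs {a b : ℤ} (hab : IsCoprime a b) {Q T : ℕ} (hQ : 1 ≤ Q)
    (hT : 4 * Q ≤ T) : Q * T ≤ 16 * #(coprimePairs a b Q T) := by
  classical
  have hcover : Ioc 0 Q ×ˢ range T ⊆ coprimePairs a b Q T ∪
      (Ioc 1 Q).biUnion fun l => if l.Prime then
        {q ∈ Ioc 0 Q | l ∣ q} ×ˢ {t ∈ range T | (l : ℤ) ∣ b + a * (t : ℕ)} else ∅ := by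
    rintro ⟨q, t⟩ hx
    obtain ⟨hq, ht⟩ := mem_product.1 hx
    have hq' := mem_Ioc.1 hq
    by_cases hcop : IsCoprime (b + a * (t : ℤ)) (q : ℤ)
    · exact mem_union_left _ (mem_filter.2 ⟨hx, hcop⟩)
    · refine mem_union_right _ ?_
      rw [Int.isCoprime_iff_gcd_eq_one] at hcop
      obtain ⟨l, hl, hdvd⟩ := Nat.exists_prime_and_dvd hcop
      have h1 : (l : ℤ) ∣ b + a * t :=
        (Int.natCast_dvd_natCast.2 hdvd).trans (Int.gcd_dvd_left _ _)
      have h2 : l ∣ q :=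
        Int.natCast_dvd_natCast.1 ((Int.natCast_dvd_natCast.2 hdvd).trans (Int.gcd_dvd_right _ _))
      rw [mem_biUnion]
      refine ⟨l, mem_Ioc.2 ⟨hl.one_lt, (Nat.le_of_dvd hq'.1 h2).trans hq'.2⟩, ?_⟩
      rw [if_pos hl, mem_product]
      exact ⟨mem_filter.2 ⟨hq, h2⟩, mem_filter.2 ⟨ht, h1⟩⟩
  have hcard := (card_le_card hcover).trans ((card_union_le _ _).trans
    (Nat.add_le_add_left card_biUnion_le _))
  rw [card_product, Nat.card_Ioc, card_range, Nat.sub_zero] at hcard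
  have hbad : ((∑ l ∈ Ioc 1 Q, #(if l.Prime then
      {q ∈ Ioc 0 Q | l ∣ q} ×ˢ {t ∈ range T | (l : ℤ) ∣ b + a * (t : ℕ)} else ∅) : ℕ) : ℝ) ≤
      15 / 16 * (Q * T) := by
    push_cast
    calc ∑ l ∈ Ioc 1 Q, (#(if l.Prime then
          {q ∈ Ioc 0 Q | l ∣ q} ×ˢ {t ∈ range T | (l : ℤ) ∣ b + a * (t : ℕ)} else ∅) : ℝ)
        ≤ ∑ l ∈ Ioc 1 Q, (5 / 4 * (Q * T)) * ((1 : ℝ) / l ^ 2) := by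
          refine sum_le_sum fun l hl => ?_
          have hl' := mem_Ioc.1 hl
          have hl0 : (0 : ℝ) < l := by exact_mod_cast (by omega : 0 < l)
          split_ifs with hprime
          · rw [card_product, Nat.Ioc_filter_dvd_card_eq_div]
            have h1 : ((Q / l : ℕ) : ℝ) ≤ Q / l := Nat.cast_div_le
            have h2 : (#{t ∈ range T | (l : ℤ) ∣ b + a * (t : ℕ)} : ℝ) ≤ 5 / 4 * (T / l) := by
              have h3 : (#{t ∈ range T | (l : ℤ) ∣ b + a * (t : ℕ)} : ℝ) ≤ (T / l : ℕ) + 1 := by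
                exact_mod_cast card_dvd_add_mul_le hab hprime T
              have h4 : ((T / l : ℕ) : ℝ) ≤ T / l := Nat.cast_div_le
              have h5 : (4 : ℝ) ≤ T / l := by
                rw [le_div_iff₀ hl0]
                exact_mod_cast (by omega : 4 * l ≤ T)
              linarith
            push_cast
            calc ((Q / l : ℕ) : ℝ) * #{t ∈ range T | (l : ℤ) ∣ b + a * (t : ℕ)}
                ≤ (Q / l) * (5 / 4 * (T / l)) := mul_le_mul h1 h2 (by positivity) (by positivity)
              _ = (5 / 4 * (Q * T)) * (1 / (l : ℝ) ^ 2) := by field_simp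
          · simp only [card_empty, Nat.cast_zero]
            positivity
      _ = 5 / 4 * (Q * T) * ∑ l ∈ Ioc 1 Q, (1 : ℝ) / l ^ 2 := by rw [mul_sum]
      _ ≤ 5 / 4 * (Q * T) * (3 / 4) := by
          exact mul_le_mul_of_nonneg_left (sum_inv_sq_le hQ) (by positivity)
      _ = 15 / 16 * (Q * T) := by ring
  have hcard' : ((Q * T : ℕ) : ℝ) ≤ _ := Nat.cast_le.2 hcard
  rw [Nat.cast_add] at hcard'
  have : ((Q * T : ℕ) : ℝ) ≤ (16 * #(coprimePairs a b Q T) : ℕ) := by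
    push_cast at hcard' hbad ⊢
    linarith
  exact_mod_cast this

/-- Dirichlet approximation modulo a prime. -/
theorem exists_small_multiple {p : ℕ} [Fact p.Prime] (u : ZMod p) {n : ℕ} (hn : 0 < n)
    (hnp : n < p) :
    ∃ a b : ℤ, 0 < a ∧ a ≤ n ∧ IsCoprime a b ∧ (a : ZMod p) * u = b ∧ |b| * (n + 1) ≤ p := by
  have hprime : p.Prime := Fact.out
  have hp0 : (0 : ℝ) < p := by exact_mod_cast hprime.pos
  obtain ⟨r, hr, hden⟩ := Real.exists_rat_abs_sub_le_and_den_le ((u.val : ℝ) / p) hn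
  have hd0 : (0 : ℝ) < r.den := by exact_mod_cast r.pos
  refine ⟨r.den, r.den * u.val - p * r.num, by exact_mod_cast r.pos, by exact_mod_cast hden,
    ?_, ?_, ?_⟩
  · have h1 : IsCoprime (r.den : ℤ) r.num :=
      (Int.isCoprime_iff_gcd_eq_one.2 (by simpa [Int.gcd] using r.reduced)).symm
    have h2 : IsCoprime (r.den : ℤ) p := by
      rw [Nat.isCoprime_iff_coprime]
      exact (Nat.coprime_of_lt_prime r.pos.ne' (hden.trans_lt hnp) hprime).symm
    have h3 := (IsCoprime.mul_right h2 h1).neg_right.add_mul_left_right u.val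
    rwa [neg_add_eq_sub] at h3
  · simp
  · have hq : ((r : ℚ) : ℝ) = r.num / r.den := by exact_mod_cast (Rat.num_div_den r).symm
    have heq : (u.val : ℝ) / p - r =
        ((r.den * u.val - p * r.num : ℤ) : ℝ) / (p * r.den) := by
      rw [hq]
      push_cast
      field_simp
    rw [heq, abs_div, abs_of_pos (by positivity : (0 : ℝ) < p * r.den), div_le_div_iff₀
      (by positivity) (by positivity)] at hr
    have hr' : |((r.den * u.val - p * r.num : ℤ) : ℝ)| * (n + 1) ≤ p := by
      refine le_of_mul_le_mul_right ?_ hd0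
      linarith
    exact_mod_cast hr'

theorem injOn_coprimePairs {p : ℕ} [Fact p.Prime] {u : ZMod p} {a b : ℤ} {Q T : ℕ}
    (ha : 0 < a) (haQ : a ≤ (4 * Q : ℕ)) (hau : (a : ZMod p) * u = b)
    (hb : |b| * ((4 * Q : ℕ) + 1) ≤ p) (hQT : 16 * Q ^ 2 * T < p) (hQp : Q < p) :
    Set.InjOn (fun x : ℕ × ℕ => (u + x.2) / (x.1 : ZMod p)) (coprimePairs a b Q T) := by
  rintro ⟨q, t⟩ hx ⟨q', t'⟩ hx' h
  simp only [coprimePairs, coe_filter, Set.mem_ofPred_eq, mem_product, mem_Ioc, mem_range] at hx hx'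
  obtain ⟨⟨⟨hq0, hqQ⟩, htT⟩, hcop⟩ := hx
  obtain ⟨⟨⟨hq0', hqQ'⟩, htT'⟩, hcop'⟩ := hx'
  have hcast : ∀ {n : ℕ}, 0 < n → n ≤ Q → (n : ZMod p) ≠ 0 := by
    intro n hn0 hnQ hn
    rw [ZMod.natCast_eq_zero_iff] at hn
    have := Nat.le_of_dvd hn0 hn
    omega
  simp only at h
  rw [div_eq_div_iff (hcast hq0 hqQ) (hcast hq0' hqQ')] at h
  have hdvd : (p : ℤ) ∣ (b + a * t) * q' - (b + a * t') * q := by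
    rw [← ZMod.intCast_zmod_eq_zero_iff_dvd]
    push_cast
    linear_combination (a : ZMod p) * h - ((q' : ZMod p) - q) * hau
  have hsize : ∀ {n s : ℕ}, n ≤ Q → s < T → 2 * |(b + a * s) * n| < p := by
    intro n s hn hs
    have h1 : |(b + a * s) * (n : ℤ)| ≤ |b| * Q + a * s * Q := by
      rw [abs_mul, Nat.abs_cast]
      have h2 : |b + a * s| ≤ |b| + a * s := by
        refine (abs_add_le _ _).trans ?_
        rw [abs_of_nonneg (by positivity : 0 ≤ a * (s : ℤ))]
      calc |b + a * s| * (n : ℤ) ≤ (|b| + a * s) * Q :=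
            mul_le_mul h2 (by exact_mod_cast hn) (by positivity) (by positivity)
        _ = |b| * Q + a * s * Q := by ring
    have h3 : a * s * Q ≤ (4 * Q : ℕ) * T * Q := by gcongr
    have h4 : ((16 * Q ^ 2 * T : ℕ) : ℤ) < p := by exact_mod_cast hQT
    have h5 := abs_nonneg b
    push_cast at *
    nlinarith
  have heq : (b + a * t) * q' = (b + a * t') * q := by
    have h1 := hsize hqQ' htT
    have h2 := hsize hqQ htT'
    have h3 := abs_sub ((b + a * t) * q') ((b + a * t') * (q : ℤ))
    exact sub_eq_zero.1 (Int.eq_zero_of_abs_lt_dvd hdvd (by linarith))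
  have hqq : q ∣ q' := by
    have h1 : (q : ℤ) ∣ (b + a * t) * q' := heq ▸ dvd_mul_left _ _
    exact Int.natCast_dvd_natCast.1 (hcop.symm.dvd_of_dvd_mul_left h1)
  have hqq' : q' ∣ q := by
    have h1 : (q' : ℤ) ∣ (b + a * t') * q := heq ▸ dvd_mul_left _ _
    exact Int.natCast_dvd_natCast.1 (hcop'.symm.dvd_of_dvd_mul_left h1)
  obtain rfl := Nat.dvd_antisymm hqq hqq'
  have hq : (q : ℤ) ≠ 0 := by exact_mod_cast hq0.ne'
  have h1 := mul_right_cancel₀ hq heq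
  have h2 := mul_left_cancel₀ ha.ne' (add_left_cancel h1)
  simpa using h2

theorem mul_le_card_runStarts {p : ℕ} [Fact p.Prime] {u : ZMod p} {δ : ℤ} {Q T k H : ℕ}
    (hδ : δ = 1 ∨ δ = -1) (hQ : 1 ≤ Q) (hT : 4 * Q ≤ T) (hQT : 16 * Q ^ 2 * T < p)
    (hH : T + Q * k ≤ H)
    (hrun : ∀ j ∈ Icc 1 H, quadraticChar (ZMod p) (u + (j : ℕ)) = δ) :
    Q * T ≤ 16 * (#(runStarts p k 1) + #(runStarts p k (-1))) := by
  classical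
  have h4Q : 4 * Q < p := by nlinarith
  obtain ⟨a, b, ha, haQ, hab, hau, hb⟩ := exists_small_multiple u (by omega : 0 < 4 * Q) h4Q
  refine (le_card_coprimePairs hab hQ hT).trans (Nat.mul_le_mul_left _ ?_)
  refine le_trans ?_ (card_union_le _ _)
  refine card_le_card_of_injOn _ (fun x hx => ?_)
    (injOn_coprimePairs ha haQ hau hb hQT (by omega))
  obtain ⟨q, t⟩ := x
  simp only [coprimePairs, coe_filter, Set.mem_ofPred_eq, mem_product, mem_Ioc, mem_range] at hx
  obtain ⟨⟨⟨hq0, hqQ⟩, htT⟩, -⟩ := hx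
  have hq : (q : ZMod p) ≠ 0 := by
    rw [Ne, ZMod.natCast_eq_zero_iff]
    intro h
    have := Nat.le_of_dvd hq0 h
    omega
  have hsq : quadraticChar (ZMod p) q * quadraticChar (ZMod p) q = 1 := by
    rw [← sq]
    exact quadraticChar_sq_one hq
  have hval : ∀ i ∈ Icc 1 k, quadraticChar (ZMod p) ((u + t) / q + (i : ℕ)) =
      quadraticChar (ZMod p) q * δ := by
    intro i hi
    obtain ⟨hi1, hik⟩ := mem_Icc.1 hi
    have hmem : t + q * i ∈ Icc 1 H := by
      have h1 : q * i ≤ Q * k := Nat.mul_le_mul hqQ hik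
      have h2 : 1 ≤ q * i := Nat.mul_pos hq0 hi1
      exact mem_Icc.2 ⟨by omega, by omega⟩
    rw [← hrun _ hmem]
    have hfac : u + ((t + q * i : ℕ) : ZMod p) = q * ((u + t) / q + (i : ℕ)) := by
      push_cast
      field_simp
      ring
    rw [hfac, map_mul, ← mul_assoc, hsq, one_mul]
  have hsign : quadraticChar (ZMod p) q * δ = 1 ∨ quadraticChar (ZMod p) q * δ = -1 := by
    rcases quadraticChar_dichotomy hq with h | h <;> rcases hδ with rfl | rfl <;> simp [h]
  rw [mem_coe, mem_union, mem_runStarts, mem_runStarts]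
  exact hsign.imp (fun h i hi => (hval i hi).trans h) fun h i hi => (hval i hi).trans h

end Runs

section Burgess

theorem exists_sign_of_mem_quadRes {p : ℕ} [Fact p.Prime] {u : ZMod p} {h : ℕ} (hh : 0 < h)
    (hmem : ∀ j ∈ Icc 1 h, (u + (j : ℕ)) * (u + (j : ℕ) + 1) ∈ quadRes p) :
    ∃ δ : ℤ, (δ = 1 ∨ δ = -1) ∧ ∀ j ∈ Icc 1 h, quadraticChar (ZMod p) (u + (j : ℕ)) = δ := by
  have hstep : ∀ j ∈ Icc 1 h, u + (j : ℕ) ≠ 0 ∧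
      quadraticChar (ZMod p) (u + (j : ℕ)) * quadraticChar (ZMod p) (u + (j : ℕ) + 1) = 1 := by
    intro j hj
    obtain ⟨y, hy, hsq⟩ := (mem_filter.1 (hmem j hj)).2
    refine ⟨fun h0 => ?_, ?_⟩
    · rw [h0, zero_mul] at hsq
      exact hy (pow_eq_zero_iff two_ne_zero |>.1 hsq)
    · rw [← map_mul, ← hsq]
      exact quadraticChar_sq_one' hy
  refine ⟨_, quadraticChar_dichotomy (hstep 1 (mem_Icc.2 ⟨le_rfl, hh⟩)).1, fun j hj => ?_⟩
  obtain ⟨hj1, hjh⟩ := mem_Icc.1 hj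
  induction j, hj1 using Nat.le_induction with
  | base => rfl
  | succ j hj1 ih =>
    have hjmem : j ∈ Icc 1 h := mem_Icc.2 ⟨hj1, by omega⟩
    rw [← ih hjmem (by omega)]
    obtain ⟨hne, hmul⟩ := hstep j hjmem
    push_cast
    rw [← add_assoc]
    rcases quadraticChar_dichotomy hne with h1 | h1 <;> rw [h1] at hmul ⊢ <;> linarith

theorem run_length_lt {p : ℕ} [Fact p.Prime] {u : ZMod p} {δ : ℤ} {h : ℕ}
    (hδ : δ = 1 ∨ δ = -1)
    (hrun : ∀ j ∈ Icc 1 h, quadraticChar (ZMod p) (u + (j : ℕ)) = δ) : h < p := by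
  have hp : 0 < p := (Fact.out : p.Prime).pos
  by_contra! hle
  have hzero : ∃ j ∈ Icc 1 h, u + (j : ℕ) = 0 := by
    have hlt := ZMod.val_lt (-u)
    rcases Nat.eq_zero_or_pos (-u).val with h0 | h0
    · rw [ZMod.val_eq_zero, neg_eq_zero] at h0
      exact ⟨p, mem_Icc.2 ⟨hp, hle⟩, by simp [h0]⟩
    · exact ⟨(-u).val, mem_Icc.2 ⟨h0, by omega⟩, by simp⟩
  obtain ⟨j, hj, hj0⟩ := hzero
  have := hrun j hj
  rw [hj0, quadraticChar_zero] at this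
  rcases hδ with rfl | rfl <;> simp at this

theorem run_length_le_of_large {p : ℕ} [Fact p.Prime] {u : ZMod p} {δ : ℤ} {h : ℕ}
    (hp : 16 ≤ p) (hlarge : 960000 * Real.logb 2 p < (p : ℝ) ^ ((1 : ℝ) / 4))
    (hδ : δ = 1 ∨ δ = -1)
    (hrun : ∀ j ∈ Icc 1 h, quadraticChar (ZMod p) (u + (j : ℕ)) = δ) :
    (h : ℝ) ≤ 124 * (p : ℝ) ^ ((1 : ℝ) / 4) * Real.logb 2 p := by
  have hp0 : (0 : ℝ) < p := by exact_mod_cast (by omega : 0 < p)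
  set y := (p : ℝ) ^ ((1 : ℝ) / 4) with hy
  set L := Real.logb 2 p with hL
  have hy4 : y ^ 4 = p := by
    rw [hy, ← Real.rpow_natCast, ← Real.rpow_mul hp0.le]
    norm_num
  have hL4 : 4 ≤ L := by
    rw [hL, Real.le_logb_iff_rpow_le (by norm_num) hp0]
    norm_num
    exact_mod_cast hp
  have hybig : 3840000 < y := by linarith
  have hyp : y ≤ p := by
    rw [← hy4]
    exact le_self_pow₀ (by linarith) (by norm_num)
  obtain ⟨k, hk⟩ : ∃ k, k = ⌈L⌉₊ := ⟨_, rfl⟩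
  obtain ⟨Q, hQ⟩ : ∃ Q, Q = ⌊30 * y⌋₊ + 1 := ⟨_, rfl⟩
  obtain ⟨m, hm⟩ : ∃ m, m = ⌊y ^ 2 / 4⌋₊ := ⟨_, rfl⟩
  have hLk : L ≤ k := by rw [hk]; exact Nat.le_ceil L
  have hkL : (k : ℝ) ≤ 2 * L := by
    have := Nat.ceil_lt_add_one (by linarith : 0 ≤ L)
    rw [hk]
    linarith
  have hQlow : 30 * y < Q := by rw [hQ]; push_cast; exact Nat.lt_floor_add_one _
  have hQup : (Q : ℝ) ≤ 31 * y := by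
    have := Nat.floor_le (by linarith : 0 ≤ 30 * y)
    rw [hQ]
    push_cast
    linarith
  have hmup : (m : ℝ) ≤ y ^ 2 / 4 := by rw [hm]; exact Nat.floor_le (by positivity)
  have hmlow : y ^ 2 / 8 ≤ m := by
    have := Nat.lt_floor_add_one (y ^ 2 / 4)
    rw [← hm] at this
    nlinarith
  have hk4 : 4 ≤ k := by exact_mod_cast hL4.trans hLk
  have hQ1 : 1 ≤ Q := by omega
  have hm1 : 1 ≤ m := by
    have : (0 : ℝ) < m := lt_of_lt_of_le (by positivity) hmlow
    exact_mod_cast this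
  have hpk : (p : ℝ) ≤ 2 ^ k := by
    rw [← Real.rpow_natCast]
    exact (Real.logb_le_iff_le_rpow (by norm_num) hp0).1 hLk
  have hky : 480000 * (k : ℝ) < y := by linarith
  have hmp : 16 * m ^ 2 ≤ p := by
    have : (16 * m ^ 2 : ℝ) ≤ p := by
      rw [← hy4]
      nlinarith [Nat.cast_nonneg (α := ℝ) m]
    exact_mod_cast this
  have hkp : 16 * k ≤ p := by
    have : (16 * k : ℝ) ≤ p := by linarith [Nat.cast_nonneg (α := ℝ) k]
    exact_mod_cast this
  have hQT : 16 * Q ^ 2 * (k * Q) < p := by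
    have : (16 * Q ^ 2 * (k * Q) : ℝ) < p := by
      calc (16 * Q ^ 2 * (k * Q) : ℝ) = 16 * k * (Q : ℝ) ^ 3 := by ring
        _ ≤ 16 * k * (31 * y) ^ 3 := by gcongr
        _ = 476656 * k * y ^ 3 := by ring
        _ < y * y ^ 3 := by
          refine mul_lt_mul_of_pos_right ?_ (by positivity)
          linarith [Nat.cast_nonneg (α := ℝ) k]
        _ = p := by rw [← hy4]; ring
    exact_mod_cast this
  by_contra! hcon
  have hH : k * Q + Q * k ≤ h := by
    have : (k * Q + Q * k : ℝ) ≤ h := by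
      have : (k * Q : ℝ) ≤ 2 * L * (31 * y) :=
        mul_le_mul hkL hQup (by positivity) (by positivity)
      linarith
    exact_mod_cast this
  have hruns := mul_le_card_runStarts hδ hQ1 (Nat.mul_le_mul_right Q hk4) hQT hH hrun
  have hpos := card_runs_le (by omega : p ≠ 2) hkp hm1 hmp (Or.inl (rfl : (1 : ℤ) = 1))
  have hneg := card_runs_le (by omega : p ≠ 2) hkp hm1 hmp (Or.inr (rfl : (-1 : ℤ) = -1))
  have hcount : m * 2 ^ k * (Q * (k * Q)) ≤ 32 * (m * p + 2 ^ k * (3 * p * k)) := by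
    have := Nat.mul_le_mul_left (m * 2 ^ k) hruns
    linarith
  have hcount' : (m * 2 ^ k * (Q * (k * Q)) : ℝ) ≤ 32 * (m * p + 2 ^ k * (3 * p * k)) := by
    exact_mod_cast hcount
  have hk1 : (1 : ℝ) ≤ k := by linarith
  have hmpk : (m * p : ℝ) ≤ 2 ^ k * k * m := by
    have : (p : ℝ) * 1 ≤ 2 ^ k * k := mul_le_mul hpk hk1 (by norm_num) (by positivity)
    nlinarith [Nat.cast_nonneg (α := ℝ) m]
  have hreduced : (m * Q ^ 2 : ℝ) ≤ 32 * m + 96 * p := by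
    refine le_of_mul_le_mul_left ?_ (by positivity : (0 : ℝ) < 2 ^ k * k)
    nlinarith
  have hm0 : (0 : ℝ) < m := by exact_mod_cast hm1
  have hpm : (p : ℝ) ≤ 8 * y ^ 2 * m := by
    rw [← hy4]
    nlinarith [sq_nonneg y]
  have hQsq : (Q : ℝ) ^ 2 ≤ 32 + 768 * y ^ 2 := by
    refine le_of_mul_le_mul_left ?_ hm0
    linarith
  nlinarith

theorem eventually_logb_lt :
    ∀ᶠ x : ℝ in Filter.atTop, 960000 * Real.logb 2 x < x ^ ((1 : ℝ) / 4) := by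
  have hlog : (0 : ℝ) < Real.log 2 := Real.log_pos (by norm_num)
  have hlittle := (isLittleO_log_rpow_atTop (by norm_num : (0 : ℝ) < 1 / 4)).def
    (by positivity : 0 < Real.log 2 / 1920000)
  filter_upwards [hlittle, Filter.eventually_gt_atTop 1] with x hx hx1
  have hpos : 0 < x ^ ((1 : ℝ) / 4) := Real.rpow_pos_of_pos (by linarith) _
  rw [Real.norm_of_nonneg (Real.log_nonneg hx1.le), Real.norm_of_nonneg hpos.le] at hx
  rw [Real.logb, mul_div_assoc', div_lt_iff₀ hlog]
  nlinarith

end Burgess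

theorem stmt5 :
    ∃ c : ℝ, 0 < c ∧
      ∀ (p : ℕ) [Fact p.Prime] (a s : ZMod p) (h : ℕ),
        0 < h →
        (∀ j ∈ Finset.Icc 1 h,
            (s + (j : ZMod p) + a) * (s + (j : ZMod p) + a + 1) ∈ quadRes p) →
        (h : ℝ) ≤ c * (p : ℝ) ^ ((1 : ℝ) / 4) * Real.logb 2 p := by
  obtain ⟨P, hP⟩ := Filter.eventually_atTop.1 eventually_logb_lt
  refine ⟨max 124 (max P 16), by positivity, fun p _ a s h hh hmem => ?_⟩
  obtain ⟨δ, hδ, hrun⟩ := exists_sign_of_mem_quadRes (u := s + a) hh fun j hj => by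
    have := hmem j hj
    rwa [add_right_comm] at this
  have hp2 : (2 : ℝ) ≤ p := by exact_mod_cast (Fact.out : p.Prime).two_le
  have hlog : 1 ≤ Real.logb 2 p := by
    rw [Real.le_logb_iff_rpow_le (by norm_num) (by linarith)]
    simpa using hp2
  have hpow : 1 ≤ (p : ℝ) ^ ((1 : ℝ) / 4) := Real.one_le_rpow (by linarith) (by norm_num)
  by_cases hlarge : max P 16 ≤ (p : ℝ)
  · have hp16 : 16 ≤ p := by exact_mod_cast (le_max_right _ _).trans hlarge
    refine (run_length_le_of_large hp16 (hP p ((le_max_left _ _).trans hlarge)) hδ hrun).trans ?_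
    gcongr
    exact le_max_left _ _
  · have hhp : (h : ℝ) ≤ p := by exact_mod_cast (run_length_lt hδ hrun).le
    have hc : (h : ℝ) ≤ max 124 (max P 16) :=
      (hhp.trans (not_le.1 hlarge).le).trans (le_max_right _ _)
    refine hc.trans ?_
    rw [mul_assoc]
    exact le_mul_of_one_le_right (by positivity) (one_le_mul_of_one_le_of_one_le hpow hlog)
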